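/- arXiv:1709.05651 — 11 statements merged into one kernel-verified Lean document; each statement's English description precedes it below -/
import Mathlib

section
/- Let b : ℕ → ℝ be Northshield's analogue of Stern's sequence, defined by b(0) = 0, b(1) = 1, and for all n ≥ 0: b(3n) = b(n), b(3n+1) = √2·b(n) + b(n+1), b(3n+2) = b(n) + √2·b(n+1). Then for every n ≥ 1, b(n) = b(n^R), where n^R is the base-3 digit reversal of n. -/
noncomputable def nsM : ℕ → Matrix (Fin 2) (Fin 2) ℝ
  | 0 => !![1, 0; Real.sqrt 2, 1]
  | 1 => !![Real.sqrt 2, 1; 1, Real.sqrt 2]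
  | _ => !![1, Real.sqrt 2; 0, 1]

def nsS (X : Matrix (Fin 2) (Fin 2) ℝ) : Matrix (Fin 2) (Fin 2) ℝ :=
  !![X 1 1, X 0 1; X 1 0, X 0 0]

theorem nsS_mul (X Y : Matrix (Fin 2) (Fin 2) ℝ) : nsS (X * Y) = nsS Y * nsS X := by
  ext i j
  fin_cases i <;> fin_cases j <;> simp [nsS, Matrix.mul_apply, Fin.sum_univ_two] <;> ring

theorem nsS_M (d : ℕ) : nsS (nsM d) = nsM d := by
  rcases d with _ | _ | d <;> simp [nsS, nsM]

theorem nsS_prod (L : List ℕ) : (L.reverse.map nsM).prod = nsS (L.map nsM).prod := by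
  induction L with
  | nil =>
    ext i j
    fin_cases i <;> fin_cases j <;> simp [nsS]
  | cons d L ih =>
    rw [List.reverse_cons, List.map_append, List.prod_append, ih]
    simp [nsS_mul, nsS_M]

theorem ns_eval (b : ℕ → ℝ)
    (h0 : b 0 = 0) (h1 : b 1 = 1)
    (h3 : ∀ n : ℕ, b (3 * n) = b n)
    (h3a : ∀ n : ℕ, b (3 * n + 1) = Real.sqrt 2 * b n + b (n + 1))
    (h3b : ∀ n : ℕ, b (3 * n + 2) = b n + Real.sqrt 2 * b (n + 1))
    (L : List ℕ) (hL : ∀ d ∈ L, d < 3) :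
    b (Nat.ofDigits 3 L) = (L.map nsM).prod 0 1 ∧
    b (Nat.ofDigits 3 L + 1) = (L.map nsM).prod 1 1 := by
  induction L with
  | nil => simp [h0, h1]
  | cons d L ih =>
    obtain ⟨ha, hb⟩ := ih (fun x hx => hL x (List.mem_cons_of_mem _ hx))
    have hd : d < 3 := hL d List.mem_cons_self
    rw [List.map_cons, List.prod_cons, Matrix.mul_apply, Matrix.mul_apply, Fin.sum_univ_two,
      Fin.sum_univ_two, ← ha, ← hb, Nat.ofDigits_cons]
    generalize Nat.ofDigits 3 L = n
    have e3 : b (3 * n + 3) = b (n + 1) := h3 (n + 1)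
    interval_cases d
    · simp [nsM, h3, h3a]
    · have e : 1 + 3 * n = 3 * n + 1 := by ring
      simp [nsM, e, h3a, h3b]
    · have e : 2 + 3 * n = 3 * n + 2 := by ring
      simp [nsM, e, e3, h3b]

/-- Northshield's analogue of Stern's sequence is invariant
under base-3 digit reversal. -/
theorem northshield_digit_reversal
    (b : ℕ → ℝ)
    (h0 : b 0 = 0) (h1 : b 1 = 1)
    (h3 : ∀ n : ℕ, b (3 * n) = b n)
    (h3a : ∀ n : ℕ, b (3 * n + 1) = Real.sqrt 2 * b n + b (n + 1))
    (h3b : ∀ n : ℕ, b (3 * n + 2) = b n + Real.sqrt 2 * b (n + 1)) :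
    ∀ n : ℕ, 1 ≤ n → b n = b (Nat.ofDigits 3 (Nat.digits 3 n).reverse) := by
  intro n _
  have hL : ∀ d ∈ Nat.digits 3 n, d < 3 := fun d hd => Nat.digits_lt_base (by norm_num) hd
  have A := (ns_eval b h0 h1 h3 h3a h3b _ hL).1
  have B := (ns_eval b h0 h1 h3 h3a h3b (Nat.digits 3 n).reverse
    (fun d hd => hL d (List.mem_reverse.mp hd))).1
  rw [Nat.ofDigits_digits] at A
  rw [A, B, nsS_prod]
  simp [nsS]
end

section
/- Let τ and σ be complex numbers and set ω = 1 − σ² + τσ. Let (a_n)_{n≥0} be a sequence of complex numbers satisfying a(0) = 0, a(1) = 1, and for all n ≥ 0: a(3n) = a(n), a(3n+1) = τ·a(n) + a(n+1), a(3n+2) = ω·a(n) + σ·a(n+1). Then a(n) = a(n^R) for every n ≥ 1, where n^R is the base-3 digit reversal of n. -/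
/-- the parametrized family of 3-regular sequences
(including Northshield's sequence) is invariant under base-3 digit
reversal. -/
theorem param_digit_reversal
    (τ σ : ℂ) (ω : ℂ) (hω : ω = 1 - σ ^ 2 + τ * σ)
    (a : ℕ → ℂ)
    (h0 : a 0 = 0) (h1 : a 1 = 1)
    (h3 : ∀ n : ℕ, a (3 * n) = a n)
    (h3a : ∀ n : ℕ, a (3 * n + 1) = τ * a n + a (n + 1))
    (h3b : ∀ n : ℕ, a (3 * n + 2) = ω * a n + σ * a (n + 1)) :
    ∀ n : ℕ, 1 ≤ n → a n = a (Nat.ofDigits 3 (Nat.digits 3 n).reverse) := by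
  have key : ∀ L : List ℕ, (∀ d ∈ L, d < 3) → ∀ K : List ℕ,
      a (Nat.ofDigits 3 (L.reverse ++ K)) =
        (τ - σ) * a (Nat.ofDigits 3 L) * a (Nat.ofDigits 3 K)
        + a (Nat.ofDigits 3 L) * a (Nat.ofDigits 3 K + 1)
        + a (Nat.ofDigits 3 L + 1) * a (Nat.ofDigits 3 K) := by
    intro L
    induction L with
    | nil =>
      intro _ K
      simp [h0, h1]
    | cons d L ih =>
      intro hd K
      have hd3 : d < 3 := hd d (by simp)
      have e : (d :: L).reverse ++ K = L.reverse ++ (d :: K) := by simp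
      rw [e, ih (fun x hx => hd x (by simp [hx])) (d :: K)]
      rw [Nat.ofDigits_cons, Nat.ofDigits_cons]
      generalize Nat.ofDigits 3 L = l
      generalize Nat.ofDigits 3 K = k
      have c0 : ∀ m, a (0 + 3 * m) = a m := fun m => by rw [← h3 m]; congr 1; omega
      have c1 : ∀ m, a (1 + 3 * m) = τ * a m + a (m + 1) := fun m => by
        rw [← h3a m]; congr 1; omega
      have c2 : ∀ m, a (2 + 3 * m) = ω * a m + σ * a (m + 1) := fun m => by
        rw [← h3b m]; congr 1; omega
      have c3 : ∀ m, a (2 + 3 * m + 1) = a (m + 1) := fun m => by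
        rw [← h3 (m + 1)]; congr 1; omega
      have c1' : ∀ m, a (0 + 3 * m + 1) = τ * a m + a (m + 1) := fun m => by
        rw [← h3a m]; congr 1; omega
      have c2' : ∀ m, a (1 + 3 * m + 1) = ω * a m + σ * a (m + 1) := fun m => by
        rw [← h3b m]; congr 1; omega
      subst hω
      have hcases : d = 0 ∨ d = 1 ∨ d = 2 := by omega
      rcases hcases with rfl | rfl | rfl
      · simp only [Nat.cast_id, c0, c1']
        ring
      · simp only [Nat.cast_id, c1, c2']
        ring
      · simp only [Nat.cast_id, c2, c3]
        ring
  intro n _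
  have h := key (Nat.digits 3 n) (fun d hd => Nat.digits_lt_base (by norm_num) hd) []
  simp [h0, h1, Nat.ofDigits_digits] at h
  exact h.symm
end

section
/- Let q ≥ 2 be an integer, ϑ a real number, and γ : ℕ → ℂ a function such that for every integer t ≥ 0, the averages (1/N)·∑_{0 ≤ n < N} e(ϑ·σ_q(n+t) − ϑ·σ_q(n)) converge to γ(t) as N → ∞. Then γ(t) = γ(t^R) for every t ≥ 1, where t^R is the base-q digit reversal of t. -/
open Filter Finset

lemma cdr_digsum (q : ℕ) (hq : 2 ≤ q) (m i : ℕ) (hi : i < q) :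
    (Nat.digits q (q * m + i)).sum = (Nat.digits q m).sum + i := by
  by_cases h : i = 0 ∧ m = 0
  · obtain ⟨rfl, rfl⟩ := h; simp
  · rw [add_comm (q * m) i, Nat.digits_add q (by omega) i m hi (by tauto)]
    simp [add_comm]

lemma cdr_rec (q : ℕ) (hq : 2 ≤ q) (z : ℂ) (hz : z ≠ 0) (γ : ℕ → ℂ)
    (hγ : ∀ t : ℕ, Tendsto
      (fun N : ℕ => (N : ℂ)⁻¹ * ∑ n ∈ Finset.range N,
        (z ^ (Nat.digits q (n + t)).sum * (z ^ (Nat.digits q n).sum)⁻¹))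
      atTop (nhds (γ t))) (t j : ℕ) (hj : j < q) :
    (q : ℂ) * γ (q * t + j) =
      (q - j : ℂ) * z ^ j * γ t + j * z ^ j * (z ^ q)⁻¹ * γ (t + 1) := by
  set f : ℕ → ℕ → ℂ := fun t n => z ^ (Nat.digits q (n + t)).sum * (z ^ (Nat.digits q n).sum)⁻¹
    with hf
  have hblock : ∀ m, ∑ i ∈ range q, f (q * t + j) (q * m + i) =
      (q - j : ℂ) * z ^ j * f t m + j * z ^ j * (z ^ q)⁻¹ * f (t + 1) m := by
    intro m
    have hqq : q = (q - j) + j := by omega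
    have h1 : ∑ i ∈ range (q - j), f (q * t + j) (q * m + i) =
        ∑ i ∈ range (q - j), z ^ j * f t m := by
      apply Finset.sum_congr rfl
      intro i hi
      rw [Finset.mem_range] at hi
      simp only [hf]
      rw [show q * m + i + (q * t + j) = q * (m + t) + (i + j) by ring,
        cdr_digsum q hq _ _ (by omega), cdr_digsum q hq _ _ (by omega)]
      field_simp
      ring
    have h2 : ∑ i ∈ range j, f (q * t + j) (q * m + ((q - j) + i)) =
        ∑ i ∈ range j, z ^ j * (z ^ q)⁻¹ * f (t + 1) m := by
      apply Finset.sum_congr rfl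
      intro i hi
      rw [Finset.mem_range] at hi
      simp only [hf]
      have e1 : q * m + ((q - j) + i) + (q * t + j) = q * (m + (t + 1)) + i := by
        have : q * (m + (t + 1)) = q * m + q * t + q := by ring
        omega
      rw [e1, cdr_digsum q hq _ _ (by omega), cdr_digsum q hq _ _ (by omega)]
      have e2 : z ^ q = z ^ (q - j) * z ^ j := by rw [← pow_add]; congr 1
      rw [e2]
      field_simp
      ring
    have h3 := Finset.sum_range_add (fun i => f (q * t + j) (q * m + i)) (q - j) j
    rw [← hqq] at h3
    rw [h3, h1, h2]
    simp only [sum_const, card_range, nsmul_eq_mul]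
    rw [Nat.cast_sub hj.le]
    ring
  have hsum : ∀ M, ∑ n ∈ range (q * M), f (q * t + j) n =
      (q - j : ℂ) * z ^ j * ∑ n ∈ range M, f t n
        + j * z ^ j * (z ^ q)⁻¹ * ∑ n ∈ range M, f (t + 1) n := by
    intro M
    induction M with
    | zero => simp
    | succ M ih =>
      rw [Nat.mul_succ, Finset.sum_range_add, ih, hblock, sum_range_succ, sum_range_succ]
      ring
  have hq0 : (q : ℂ) ≠ 0 := by exact_mod_cast (by omega : q ≠ 0)
  have hmul : Tendsto (fun M : ℕ => q * M) atTop atTop :=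
    tendsto_id.const_mul_atTop' (by omega)
  have l1 := ((hγ (q * t + j)).comp hmul).const_mul (q : ℂ)
  have l2 := ((hγ t).const_mul ((q - j : ℂ) * z ^ j)).add
    ((hγ (t + 1)).const_mul (j * z ^ j * (z ^ q)⁻¹))
  refine tendsto_nhds_unique l1 (l2.congr ?_)
  intro M
  have := hsum M
  simp only [hf] at this
  simp only [Function.comp]
  rw [this]
  push_cast
  rw [mul_inv]
  field_simp

lemma cdr_exp (ϑ : ℝ) (a b : ℕ) :
    Complex.exp (2 * Real.pi * Complex.I * ((ϑ : ℂ) * (a : ℂ) - (ϑ : ℂ) * (b : ℂ))) =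
    Complex.exp (2 * Real.pi * Complex.I * ϑ) ^ a *
      (Complex.exp (2 * Real.pi * Complex.I * ϑ) ^ b)⁻¹ := by
  rw [← Complex.exp_nat_mul, ← Complex.exp_nat_mul, ← Complex.exp_neg, ← Complex.exp_add]
  congr 1; ring

lemma cdr_rev (A : ℕ → Matrix (Fin 2) (Fin 2) ℂ) (S : Matrix (Fin 2) (Fin 2) ℂ)
    (L : List ℕ) (hA : ∀ j ∈ L, A j * S = S * (A j).transpose) :
    (L.map A).prod * S = S * ((L.reverse.map A).prod).transpose := by
  induction L with
  | nil => simp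
  | cons a L ih =>
    simp only [List.map_cons, List.prod_cons, List.reverse_cons, List.map_append, List.map_nil,
      List.prod_append, List.prod_nil, mul_one, Matrix.transpose_mul]
    rw [mul_assoc, ih (fun j hj => hA j (List.mem_cons_of_mem _ hj)), ← mul_assoc,
      hA a List.mem_cons_self, mul_assoc]

/-- the correlation γ_t(ϑ) of the base-q sum-of-digits
function is invariant under base-q digit reversal. Here
e(x) = exp(2πix) and σ_q(n) = (Nat.digits q n).sum. -/
theorem correlation_digit_reversal
    (q : ℕ) (hq : 2 ≤ q) (ϑ : ℝ) (γ : ℕ → ℂ)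
    (hγ : ∀ t : ℕ, Tendsto
      (fun N : ℕ => (N : ℂ)⁻¹ * ∑ n ∈ Finset.range N,
        Complex.exp (2 * Real.pi * Complex.I *
          ((ϑ : ℂ) * ((Nat.digits q (n + t)).sum : ℂ)
            - (ϑ : ℂ) * ((Nat.digits q n).sum : ℂ))))
      atTop (nhds (γ t))) :
    ∀ t : ℕ, 1 ≤ t → γ t = γ (Nat.ofDigits q (Nat.digits q t).reverse) := by
  intro t _
  simp only [cdr_exp] at hγ
  have hz : Complex.exp (2 * Real.pi * Complex.I * ϑ) ≠ 0 := Complex.exp_ne_zero _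
  generalize Complex.exp (2 * Real.pi * Complex.I * ϑ) = z at hγ hz
  have hrec := cdr_rec q hq z hz γ hγ
  have hq0 : (q : ℂ) ≠ 0 := by exact_mod_cast (by omega : q ≠ 0)
  have hγ0 : γ 0 = 1 := by
    refine tendsto_nhds_unique (hγ 0) (tendsto_const_nhds.congr' ?_)
    filter_upwards [eventually_gt_atTop 0] with N hN
    have : (N : ℂ) ≠ 0 := by exact_mod_cast hN.ne'
    simp [hz, this]
  have hg := hrec 0 1 (by omega)
  simp only [mul_zero, zero_add, hγ0, pow_one, Nat.cast_one, mul_one, one_mul] at hg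
  have hrec0 : ∀ t, γ (q * t) = γ t := by
    intro t
    have := hrec t 0 (by omega)
    simpa [hq0] using this
  let a : ℕ → ℂ := fun j => (q - j : ℂ) / q * z ^ j
  let b : ℕ → ℂ := fun j => (j : ℂ) / q * z ^ j * (z ^ q)⁻¹
  have hrec' : ∀ t j, j ≤ q → γ (q * t + j) = a j * γ t + b j * γ (t + 1) := by
    intro t j hj
    rcases hj.lt_or_eq with h | h
    · apply mul_left_cancel₀ hq0
      rw [hrec t j h]
      simp only [a, b]
      field_simp
    · subst h
      rw [← Nat.mul_succ, hrec0]
      simp only [a, b]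
      field_simp
      simp
  let A : ℕ → Matrix (Fin 2) (Fin 2) ℂ := fun j => !![a j, b j; a (j + 1), b (j + 1)]
  let S : Matrix (Fin 2) (Fin 2) ℂ := !![1, γ 1; γ 1, z ^ q * (γ 1 - z) + z * γ 1]
  have hAS : ∀ j, A j * S = S * (A j).transpose := by
    intro j
    have key : a j * γ 1 + b j * (z ^ q * (γ 1 - z) + z * γ 1) = a (j + 1) + b (j + 1) * γ 1 := by
      simp only [a, b]
      have hzq : z ^ q ≠ 0 := pow_ne_zero _ hz
      generalize z ^ q = w at *
      push_cast
      field_simp at hg ⊢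
      rw [pow_succ]
      linear_combination (z ^ j) * hg
    ext i k
    fin_cases i <;> fin_cases k <;> simp [A, S, Matrix.mul_apply, Fin.sum_univ_two]
    · ring
    · linear_combination key
    · linear_combination -key
    · ring
  have hSS : S.transpose = S := by
    ext i k
    fin_cases i <;> fin_cases k <;> simp [S]
  have hval : ∀ L : List ℕ, (∀ d ∈ L, d < q) →
      γ (Nat.ofDigits q L) = ((L.map A).prod * S) 0 0 ∧
      γ (Nat.ofDigits q L + 1) = ((L.map A).prod * S) 1 0 := by
    intro L
    induction L with
    | nil => intro _; simp [S, hγ0]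
    | cons d L ih =>
      intro h
      obtain ⟨i1, i2⟩ := ih (fun x hx => h x (List.mem_cons_of_mem _ hx))
      have hd := h d List.mem_cons_self
      simp only [List.map_cons, List.prod_cons, mul_assoc]
      rw [Nat.ofDigits_cons, Matrix.mul_apply, Matrix.mul_apply, Fin.sum_univ_two,
        Fin.sum_univ_two, ← i1, ← i2]
      constructor
      · rw [add_comm, hrec' _ _ hd.le]; simp [A]
      · rw [show d + q * Nat.ofDigits q L + 1 = q * Nat.ofDigits q L + (d + 1) by ring,
          hrec' _ _ hd]; simp [A]
  have hd : ∀ d ∈ Nat.digits q t, d < q := fun d h => Nat.digits_lt_base (by omega) h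
  have h1 := (hval _ hd).1
  have h2 := (hval (Nat.digits q t).reverse (by simpa using hd)).1
  rw [Nat.ofDigits_digits] at h1
  rw [h1, h2, cdr_rev A S _ (fun j _ => hAS j)]
  conv_lhs => rw [← hSS, ← Matrix.transpose_mul, Matrix.transpose_apply]
end

section
/- Let q ≥ 2 be an integer, ϑ a real number, and γ : ℕ → ℂ a function satisfying γ(0) = 1 and the recurrence γ(qt + k) = ((q − k)/q)·e(ϑk)·γ(t) + (k/q)·e(−ϑ(q − k))·γ(t+1) for all integers t ≥ 0 and all k ∈ {0, 1, …, q−1}, where e(x) = exp(2πix). Then γ(t) = γ(t^R) for every t ≥ 1, where t^R is the base-q digit reversal of t. -/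
theorem bes_core (q : ℕ) (hq : 2 ≤ q) (γ : ℕ → ℂ) (ω z Z : ℂ) (h0 : γ 0 = 1)
    (hZ : ω ^ q = Z) (hzZ : z * Z = 1) (hω : ‖ω‖ = 1) (hz : ‖z‖ = 1)
    (hrec : ∀ t k : ℕ, k < q → (q : ℂ) * γ (q * t + k) =
      ((q : ℂ) - k) * ω ^ k * γ t + k * (ω ^ k * z) * γ (t + 1))
    (L : List ℕ) (hL : ∀ k ∈ L, k < q) :
    γ (Nat.ofDigits q L) = γ (Nat.ofDigits q L.reverse) := by
  have hq0 : (q : ℂ) ≠ 0 := by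
    have : q ≠ 0 := by omega
    exact_mod_cast this
  have hω0 : ω ≠ 0 := by
    intro h; rw [h] at hω; simp at hω
  have hrec2 : ∀ t k : ℕ, k < q → (q : ℂ) * γ (q * t + k + 1) =
      ((q : ℂ) - k - 1) * ω ^ k * ω * γ t + (k + 1) * (ω ^ k * ω * z) * γ (t + 1) := by
    intro t k hk
    rcases Nat.lt_or_ge (k + 1) q with h | h
    · have := hrec t (k + 1) h
      rw [← add_assoc] at this
      rw [this]; push_cast; ring
    · have hkq : k + 1 = q := by omega
      have h1 : q * t + k + 1 = q * (t + 1) + 0 := by rw [← hkq]; ring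
      have h2 := hrec (t + 1) 0 (by omega)
      have h3 : ω ^ k * ω = Z := by rw [← pow_succ, hkq, hZ]
      have h4 : (q : ℂ) = k + 1 := by rw [← hkq]; push_cast; ring
      rw [h1, h2, h3]
      simp only [h4]
      push_cast
      linear_combination (-(k + 1) * γ (t + 1)) * hzZ
  have hw : (q : ℂ) - ω * z ≠ 0 := by
    intro h
    have h1 : (q : ℂ) = ω * z := by linear_combination h
    have h2 : ‖(q : ℂ)‖ = 1 := by rw [h1, norm_mul, hω, hz, one_mul]
    rw [Complex.norm_natCast] at h2
    have : q = 1 := by exact_mod_cast h2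
    omega
  have hg1 : ((q : ℂ) - ω * z) * γ 1 = (q - 1) * ω := by
    have := hrec 0 1 (by omega)
    simp [h0] at this
    linear_combination this
  by_cases hy : ω * z = 1
  · have key : ∀ L : List ℕ, (∀ k ∈ L, k < q) →
        γ (Nat.ofDigits q L) = ω ^ L.sum ∧ γ (Nat.ofDigits q L + 1) = ω ^ L.sum * ω := by
      intro L
      induction L with
      | nil =>
        intro _
        rw [hy] at hg1 hw
        simp [h0]
        exact mul_left_cancel₀ hw hg1
      | cons k L ih =>
        intro h
        obtain ⟨i1, i2⟩ := ih (fun j hj => h j (by simp [hj]))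
        have hk := h k (by simp)
        have e : Nat.ofDigits q (k :: L) = q * Nat.ofDigits q L + k := by
          rw [Nat.ofDigits_cons]; simp [add_comm]
        rw [e, List.sum_cons, pow_add]
        constructor
        · apply mul_left_cancel₀ hq0
          rw [hrec _ _ hk, i1, i2]
          linear_combination (k * ω ^ k * ω ^ L.sum) * hy
        · apply mul_left_cancel₀ hq0
          rw [hrec2 _ _ hk, i1, i2]
          linear_combination ((k + 1) * ω ^ k * ω ^ L.sum * ω) * hy
    rw [(key L hL).1, (key L.reverse (by simpa using hL)).1, List.sum_reverse]
  · obtain ⟨B, hB⟩ : ∃ B : ℕ → ℕ → ℂ, ∀ n m, B n m =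
        (q * ω ^ 2 - ω * Z) * γ n * γ m
          + (-((q : ℂ) - 1) * ω) * (γ n * γ (m + 1) + γ (n + 1) * γ m)
          + (q - ω * z) * γ (n + 1) * γ (m + 1) := ⟨_, fun _ _ => rfl⟩
    have hadj : ∀ n m k, k < q → B n (q * m + k) = B (q * n + k) m := by
      intro n m k hk
      apply mul_left_cancel₀ hq0
      rw [hB, hB]
      have a1 := hrec n k hk
      have a2 := hrec2 n k hk
      have b1 := hrec m k hk
      have b2 := hrec2 m k hk
      linear_combination ((q * ω ^ 2 - ω * Z) * γ n + (-((q : ℂ) - 1) * ω) * γ (n + 1)) * b1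
        + ((-((q : ℂ) - 1) * ω) * γ n + (q - ω * z) * γ (n + 1)) * b2
        - ((q * ω ^ 2 - ω * Z) * γ m + (-((q : ℂ) - 1) * ω) * γ (m + 1)) * a1
        - ((-((q : ℂ) - 1) * ω) * γ m + (q - ω * z) * γ (m + 1)) * a2
        + (k * ω ^ k * ω * (γ (n + 1) * γ m - γ n * γ (m + 1))) * hzZ
    have hlist : ∀ L A : List ℕ, (∀ k ∈ L, k < q) →
        B (Nat.ofDigits q A) (Nat.ofDigits q L) = B (Nat.ofDigits q (L.reverse ++ A)) 0 := by
      intro L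
      induction L with
      | nil => intro A _; simp
      | cons k L ih =>
        intro A h
        have hk := h k (by simp)
        have e : ∀ L, Nat.ofDigits q (k :: L) = q * Nat.ofDigits q L + k := by
          intro L
          rw [Nat.ofDigits_cons]; simp [add_comm]
        rw [e, hadj _ _ _ hk, ← e, ih _ (fun j hj => h j (by simp [hj]))]
        simp
    obtain ⟨c, hc⟩ : ∃ c : ℂ, c = (q * ω ^ 2 - ω * Z) + (-((q : ℂ) - 1) * ω) * γ 1 := ⟨_, rfl⟩
    have hc0 : c ≠ 0 := by
      intro h
      rw [h] at hc
      apply hy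
      have h1 : (q : ℂ) * ω * ω * (ω * z - 1) ^ 2 = 0 := by
        linear_combination
          (ω * z) * (q - ω * z) * hc - (ω * z) * ((q : ℂ) - 1) * ω * hg1
          - (q * ω ^ 2 - ω ^ 3 * z) * hzZ
      have h2 : (ω * z - 1) ^ 2 = 0 := by
        rcases mul_eq_zero.1 h1 with h | h
        · exact absurd h (mul_ne_zero (mul_ne_zero hq0 hω0) hω0)
        · exact h
      linear_combination pow_eq_zero_iff (two_ne_zero) |>.1 h2
    have hl : ∀ m, B 0 m = c * γ m := by
      intro m
      rw [hB, hc, h0, zero_add]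
      linear_combination γ (m + 1) * hg1
    have hr : ∀ m, B m 0 = c * γ m := by
      intro m
      rw [hB, hc, h0, zero_add]
      linear_combination γ (m + 1) * hg1
    have := hlist L [] hL
    simp only [Nat.ofDigits_nil, List.append_nil] at this
    rw [hl, hr] at this
    exact mul_left_cancel₀ hc0 this

/-- any function satisfying Bésineau's recurrence for the
correlations of the base-q sum-of-digits function is invariant under
base-q digit reversal. Here e(x) = exp(2πix). -/
theorem besineau_recurrence_digit_reversal
    (q : ℕ) (hq : 2 ≤ q) (ϑ : ℝ) (γ : ℕ → ℂ)
    (h0 : γ 0 = 1)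
    (hrec : ∀ t : ℕ, ∀ k : ℕ, k < q →
      γ (q * t + k) =
        ((q : ℂ) - (k : ℂ)) / (q : ℂ) *
            Complex.exp (2 * Real.pi * Complex.I * ((ϑ : ℂ) * (k : ℂ))) * γ t
          + (k : ℂ) / (q : ℂ) *
            Complex.exp (2 * Real.pi * Complex.I *
              (-(ϑ : ℂ) * ((q : ℂ) - (k : ℂ)))) * γ (t + 1)) :
    ∀ t : ℕ, 1 ≤ t → γ t = γ (Nat.ofDigits q (Nat.digits q t).reverse) := by
  intro t _
  have hq0 : (q : ℂ) ≠ 0 := by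
    have : q ≠ 0 := by omega
    exact_mod_cast this
  have key := bes_core q hq γ (Complex.exp (2 * Real.pi * Complex.I * ϑ))
    (Complex.exp (2 * Real.pi * Complex.I * (-ϑ * q)))
    (Complex.exp (2 * Real.pi * Complex.I * (ϑ * q))) h0
    (by rw [← Complex.exp_nat_mul]; congr 1; ring)
    (by rw [← Complex.exp_add, ← Complex.exp_zero]; congr 1; ring)
    (by
      rw [← Complex.norm_exp_ofReal_mul_I (2 * Real.pi * ϑ)]
      congr 2; push_cast; ring)
    (by
      rw [← Complex.norm_exp_ofReal_mul_I (2 * Real.pi * (-ϑ * q))]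
      congr 2; push_cast; ring)
    (by
      intro t k hk
      rw [hrec t k hk, ← Complex.exp_nat_mul, ← Complex.exp_add]
      have e1 : (2 * Real.pi * Complex.I * ((ϑ : ℂ) * (k : ℂ))) =
        (k : ℂ) * (2 * Real.pi * Complex.I * ϑ) := by ring
      have e2 : (2 * Real.pi * Complex.I * (-(ϑ : ℂ) * ((q : ℂ) - (k : ℂ)))) =
        (k : ℂ) * (2 * Real.pi * Complex.I * ϑ) + 2 * Real.pi * Complex.I * (-ϑ * q) := by ring
      rw [e1, e2]
      field_simp)
    (Nat.digits q t) (fun k hk => Nat.digits_lt_base (by omega) hk)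
  rwa [Nat.ofDigits_digits] at key
end

section
/- Let q ≥ 2 be an integer, ϑ a real number, and γ : ℕ → ℂ a function satisfying γ(0) = 1 and the recurrence γ(qt + k) = ((q − k)/q)·e(ϑk)·γ(t) + (k/q)·e(−ϑ(q − k))·γ(t+1) for all integers t ≥ 0 and all k ∈ {0, 1, …, q−1}, where e(x) = exp(2πix). Then q·e(−ϑ) − e(−ϑq) ≠ 0 and γ(1) = (q − 1)/(q·e(−ϑ) − e(−ϑq)). -/
/-- the value at 1 of any function satisfying Bésineau's
recurrence is (q-1)/(q·e(-ϑ) - e(-ϑq)), and this denominator is nonzero.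
Here e(x) = exp(2πix). -/
theorem besineau_value_at_one
    (q : ℕ) (hq : 2 ≤ q) (ϑ : ℝ) (γ : ℕ → ℂ)
    (h0 : γ 0 = 1)
    (hrec : ∀ t : ℕ, ∀ k : ℕ, k < q →
      γ (q * t + k) =
        ((q : ℂ) - (k : ℂ)) / (q : ℂ) *
            Complex.exp (2 * Real.pi * Complex.I * ((ϑ : ℂ) * (k : ℂ))) * γ t
          + (k : ℂ) / (q : ℂ) *
            Complex.exp (2 * Real.pi * Complex.I *
              (-(ϑ : ℂ) * ((q : ℂ) - (k : ℂ)))) * γ (t + 1)) :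
    (q : ℂ) * Complex.exp (2 * Real.pi * Complex.I * (-(ϑ : ℂ)))
        - Complex.exp (2 * Real.pi * Complex.I * (-(ϑ : ℂ) * (q : ℂ))) ≠ 0
    ∧ γ 1 = ((q : ℂ) - 1) /
        ((q : ℂ) * Complex.exp (2 * Real.pi * Complex.I * (-(ϑ : ℂ)))
          - Complex.exp (2 * Real.pi * Complex.I * (-(ϑ : ℂ) * (q : ℂ)))) := by
  have hq0 : (q : ℂ) ≠ 0 := by
    have : q ≠ 0 := by omega
    exact_mod_cast this
  have hD : (q : ℂ) * Complex.exp (2 * Real.pi * Complex.I * (-(ϑ : ℂ)))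
        - Complex.exp (2 * Real.pi * Complex.I * (-(ϑ : ℂ) * (q : ℂ))) ≠ 0 := by
    intro h
    have h1 := congrArg norm (sub_eq_zero.mp h)
    rw [norm_mul, Complex.norm_exp, Complex.norm_exp, Complex.norm_natCast] at h1
    simp at h1
    omega
  refine ⟨hD, ?_⟩
  have h := hrec 0 1 (by omega)
  have e1 : Complex.exp (2 * Real.pi * Complex.I * ((ϑ : ℂ) * ((1 : ℕ) : ℂ)))
      = (Complex.exp (2 * Real.pi * Complex.I * (-(ϑ : ℂ))))⁻¹ := by
    rw [← Complex.exp_neg]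
    congr 1
    push_cast
    ring
  have e2 : Complex.exp (2 * Real.pi * Complex.I * (-(ϑ : ℂ) * ((q : ℂ) - ((1 : ℕ) : ℂ))))
      = Complex.exp (2 * Real.pi * Complex.I * (-(ϑ : ℂ) * (q : ℂ))) *
        (Complex.exp (2 * Real.pi * Complex.I * (-(ϑ : ℂ))))⁻¹ := by
    rw [← Complex.exp_neg, ← Complex.exp_add]
    congr 1
    push_cast
    ring
  rw [e1, e2, h0] at h
  have ha := Complex.exp_ne_zero (2 * Real.pi * Complex.I * (-(ϑ : ℂ)))
  rw [eq_div_iff hD]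
  generalize Complex.exp (2 * Real.pi * Complex.I * (-(ϑ : ℂ))) = a at *
  generalize Complex.exp (2 * Real.pi * Complex.I * (-(ϑ : ℂ) * (q : ℂ))) = b at *
  simp only [mul_zero, zero_add, Nat.cast_one] at h
  generalize γ 1 = g at *
  field_simp at h
  linear_combination h
end

section
/- Let x and y be complex numbers and let (z_n)_{n≥0} be a sequence of complex numbers satisfying z(2n) = z(n) and z(2n+1) = x·z(n) + y·z(n+1) for all n ≥ 1. Then z(n) = z(n^R) for every n ≥ 1, where n^R is the base-2 digit reversal of n. -/
def sternAct (x y : ℂ) (b : ℕ) (v : ℂ × ℂ) : ℂ × ℂ :=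
  if b = 0 then (v.1, x * v.1 + y * v.2) else (x * v.1 + y * v.2, v.2)

def sternQ (x y : ℂ) (u v : ℂ × ℂ) : ℂ :=
  x * (x - 1) * u.1 * v.1 + x * y * (u.1 * v.2 + u.2 * v.1) + y * (y - 1) * u.2 * v.2

lemma sternQ_act (x y : ℂ) (b : ℕ) (u v : ℂ × ℂ) :
    sternQ x y (sternAct x y b u) v = sternQ x y u (sternAct x y b v) := by
  unfold sternQ sternAct
  split_ifs <;> simp only <;> ring

lemma sternQ_fold (x y : ℂ) (L : List ℕ) : ∀ (u v : ℂ × ℂ),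
    sternQ x y (L.foldr (sternAct x y) u) v
      = sternQ x y u (L.reverse.foldr (sternAct x y) v) := by
  induction L with
  | nil => intro u v; simp
  | cons b L ih =>
    intro u v
    rw [List.foldr_cons, sternQ_act, ih, List.reverse_cons, List.foldr_append]
    simp

lemma stern_pos (L : List ℕ) : 1 ≤ Nat.ofDigits 2 (L ++ [1]) := by
  induction L with
  | nil => simp
  | cons b L ih => rw [List.cons_append, Nat.ofDigits_cons]; omega

lemma stern_fold (x y : ℂ) (z : ℕ → ℂ)
    (h2 : ∀ n : ℕ, 1 ≤ n → z (2 * n) = z n)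
    (h2a : ∀ n : ℕ, 1 ≤ n → z (2 * n + 1) = x * z n + y * z (n + 1))
    (L : List ℕ) (hL : ∀ b ∈ L, b < 2) :
    z (Nat.ofDigits 2 (L ++ [1])) = z 1 * (L.foldr (sternAct x y) (1, 1)).1 ∧
    z (Nat.ofDigits 2 (L ++ [1]) + 1) = z 1 * (L.foldr (sternAct x y) (1, 1)).2 := by
  induction L with
  | nil => simpa using h2 1 le_rfl
  | cons b L ih =>
    obtain ⟨i1, i2⟩ := ih (fun b hb => hL b (List.mem_cons_of_mem _ hb))
    have hp := stern_pos L
    have hb : b < 2 := hL b (by simp)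
    rw [List.cons_append, Nat.ofDigits_cons, List.foldr_cons]
    generalize Nat.ofDigits 2 (L ++ [1]) = n at *
    generalize L.foldr (sternAct x y) (1, 1) = w at *
    unfold sternAct
    interval_cases b
    · simp only [zero_add, if_true]
      rw [h2 n hp, h2a n hp, i1, i2]
      exact ⟨rfl, by ring⟩
    · simp only [one_ne_zero, if_false]
      rw [show 1 + 2 * n + 1 = 2 * (n + 1) by ring, show 1 + 2 * n = 2 * n + 1 by ring,
        h2 _ (by omega), h2a n hp, i1, i2]
      exact ⟨by ring, rfl⟩

lemma stern_digits (m : ℕ) (hm : 1 ≤ m) :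
    ∃ L : List ℕ, (∀ b ∈ L, b < 2) ∧ Nat.digits 2 m = L ++ [1] := by
  have hne : Nat.digits 2 m ≠ [] := Nat.digits_ne_nil_iff_ne_zero.2 (by omega)
  have h := List.dropLast_append_getLast hne
  have h0 := Nat.getLast_digit_ne_zero 2 (m := m) (by omega)
  have h1 : (Nat.digits 2 m).getLast hne < 2 :=
    Nat.digits_lt_base (by norm_num) (List.getLast_mem hne)
  have h3 : (Nat.digits 2 m).getLast hne = 1 := by omega
  refine ⟨(Nat.digits 2 m).dropLast, fun b hb => ?_, ?_⟩
  · exact Nat.digits_lt_base (by norm_num) (List.mem_of_mem_dropLast hb)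
  · rw [h3] at h; exact h.symm

lemma stern_const (x y : ℂ) (z : ℕ → ℂ) (hxy : x + y = 1)
    (h2 : ∀ n : ℕ, 1 ≤ n → z (2 * n) = z n)
    (h2a : ∀ n : ℕ, 1 ≤ n → z (2 * n + 1) = x * z n + y * z (n + 1)) (n : ℕ) :
    1 ≤ n → z n = z 1 := by
  induction n using Nat.strong_induction_on with
  | _ n ih =>
    intro hn
    rcases Nat.even_or_odd' n with ⟨m, rfl | rfl⟩
    · rw [h2 m (by omega)]; exact ih m (by omega) (by omega)
    · rcases Nat.eq_zero_or_pos m with rfl | hm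
      · rfl
      · rw [h2a m hm, ih m (by omega) hm, ih (m + 1) (by omega) (by omega), ← add_mul, hxy, one_mul]

/-- any sequence satisfying the Stern-type recurrence with
parameters x, y is invariant under base-2 digit reversal. -/
theorem stern_type_digit_reversal
    (x y : ℂ) (z : ℕ → ℂ)
    (h2 : ∀ n : ℕ, 1 ≤ n → z (2 * n) = z n)
    (h2a : ∀ n : ℕ, 1 ≤ n → z (2 * n + 1) = x * z n + y * z (n + 1)) :
    ∀ n : ℕ, 1 ≤ n → z n = z (Nat.ofDigits 2 (Nat.digits 2 n).reverse) := by
  intro n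
  induction n using Nat.strong_induction_on with
  | _ n ih =>
    intro hn
    rcases Nat.even_or_odd' n with ⟨m, rfl | rfl⟩
    · have hd : Nat.digits 2 (2 * m) = 0 :: Nat.digits 2 m := by
        have := Nat.digits_add 2 (by norm_num) 0 m (by norm_num) (Or.inr (by omega))
        simpa using this
      rw [h2 m (by omega), ih m (by omega) (by omega), hd, List.reverse_cons, Nat.ofDigits_append]
      simp
    · rcases Nat.eq_zero_or_pos m with rfl | hm
      · simp
      · have hd : Nat.digits 2 (2 * m + 1) = 1 :: Nat.digits 2 m := by
          have := Nat.digits_add 2 (by norm_num) 1 m (by norm_num) (Or.inr (by omega))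
          rwa [add_comm] at this
        obtain ⟨L, hL, hLm⟩ := stern_digits m hm
        have hm' : m = Nat.ofDigits 2 (L ++ [1]) := by rw [← hLm, Nat.ofDigits_digits]
        have hr : Nat.ofDigits 2 (Nat.digits 2 (2 * m + 1)).reverse
            = 2 * Nat.ofDigits 2 (L.reverse ++ [1]) + 1 := by
          rw [hd, hLm]
          simp only [List.reverse_cons, List.reverse_append, List.reverse_nil, List.nil_append,
            List.cons_append]
          rw [Nat.ofDigits_cons, add_comm]
        rw [hr]
        by_cases hxy : x + y = 1
        · rw [stern_const x y z hxy h2 h2a _ hn,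
            stern_const x y z hxy h2 h2a (2 * Nat.ofDigits 2 (L.reverse ++ [1]) + 1) (by omega)]
        · have ht : x + y - 1 ≠ 0 := sub_ne_zero.2 hxy
          obtain ⟨a1, a2⟩ := stern_fold x y z h2 h2a L hL
          obtain ⟨b1, b2⟩ := stern_fold x y z h2 h2a L.reverse
            (fun b hb => hL b (List.mem_reverse.1 hb))
          have hq := sternQ_fold x y L (1, 1) (1, 1)
          rw [h2a m hm, h2a _ (stern_pos _), hm', a1, a2, b1, b2]
          unfold sternQ at hq
          apply mul_left_cancel₀ ht
          linear_combination z 1 * hq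
end

section
/- Let s : ℕ → ℕ be Stern's diatomic sequence, defined by s(0) = 0, s(1) = 1, and for all n ≥ 1: s(2n) = s(n), s(2n+1) = s(n) + s(n+1). Then s(n) = s(n^R) for every n ≥ 1, where n^R is the base-2 digit reversal of n. -/
def sternM (d : ℕ) : Matrix (Fin 2) (Fin 2) ℕ :=
  if d = 0 then !![1, 0; 1, 1] else !![1, 1; 0, 1]

def sternP (L : List ℕ) : Matrix (Fin 2) (Fin 2) ℕ := (L.map sternM).prod

lemma sternP_reverse (L : List ℕ) :
    sternP L.reverse = !![0, 1; 1, 0] * (sternP L).transpose * !![0, 1; 1, 0] := by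
  have hJ : (!![0, 1; 1, 0] : Matrix (Fin 2) (Fin 2) ℕ) * !![0, 1; 1, 0] = 1 := by decide
  induction L with
  | nil => simp only [sternP, List.reverse_nil, List.map_nil, List.prod_nil,
      Matrix.transpose_one, mul_one, hJ]
  | cons d L ih =>
    have hM : sternM d = !![0, 1; 1, 0] * (sternM d).transpose * !![0, 1; 1, 0] := by
      unfold sternM; split_ifs <;> decide
    have e1 : sternP (d :: L).reverse = sternP L.reverse * sternM d := by
      simp [sternP]
    have e2 : sternP (d :: L) = sternM d * sternP L := by simp [sternP]
    rw [e1, e2, ih, hM, Matrix.transpose_mul, ← hM]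
    calc _ = !![0, 1; 1, 0] * (sternP L).transpose * (!![0, 1; 1, 0] * !![0, 1; 1, 0])
          * (sternM d).transpose * !![0, 1; 1, 0] := by
            conv_lhs => rw [hM]
            simp only [mul_assoc]
      _ = _ := by rw [hJ]; simp only [mul_assoc, one_mul]

lemma stern_eq (s : ℕ → ℕ) (h0 : s 0 = 0) (h1 : s 1 = 1)
    (h2 : ∀ n : ℕ, s (2 * n) = s n)
    (h2a : ∀ n : ℕ, s (2 * n + 1) = s n + s (n + 1)) (L : List ℕ) (hL : ∀ d ∈ L, d < 2) :
    s (Nat.ofDigits 2 L) = sternP L 0 1 ∧ s (Nat.ofDigits 2 L + 1) = sternP L 1 1 := by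
  induction L with
  | nil => simp [sternP, h0, h1]
  | cons d L ih =>
    obtain ⟨a, b⟩ := ih fun x hx => hL x (by simp [hx])
    have hd := hL d (by simp)
    have e2 : sternP (d :: L) = sternM d * sternP L := by simp [sternP]
    rw [e2, Nat.ofDigits_cons]
    generalize Nat.ofDigits 2 L = m at *
    have h3 : s (1 + 2 * m + 1) = s (m + 1) := by
      rw [← h2 (m + 1)]; congr 1; ring
    interval_cases d
    · simp [sternM, Matrix.mul_apply, Fin.sum_univ_two, h2, h2a, a, b]
    · simp [sternM, Matrix.mul_apply, Fin.sum_univ_two, h3, add_comm 1 (2 * m), h2a, a, b]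
      rw [← b, ← h3, add_comm 1]

/-- Stern's diatomic sequence is invariant under base-2
digit reversal. -/
theorem stern_digit_reversal
    (s : ℕ → ℕ)
    (h0 : s 0 = 0) (h1 : s 1 = 1)
    (h2 : ∀ n : ℕ, 1 ≤ n → s (2 * n) = s n)
    (h2a : ∀ n : ℕ, 1 ≤ n → s (2 * n + 1) = s n + s (n + 1)) :
    ∀ n : ℕ, 1 ≤ n → s n = s (Nat.ofDigits 2 (Nat.digits 2 n).reverse) := by
  intro n _
  have g2 : ∀ n : ℕ, s (2 * n) = s n := by
    intro n
    rcases Nat.eq_zero_or_pos n with rfl | h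
    · rfl
    · exact h2 n h
  have g2a : ∀ n : ℕ, s (2 * n + 1) = s n + s (n + 1) := by
    intro n
    rcases Nat.eq_zero_or_pos n with rfl | h
    · simp [h0]
    · exact h2a n h
  have hd : ∀ d ∈ Nat.digits 2 n, d < 2 := fun d hd => Nat.digits_lt_base (by norm_num) hd
  have A := (stern_eq s h0 h1 g2 g2a _ hd).1
  have B := (stern_eq s h0 h1 g2 g2a (Nat.digits 2 n).reverse
    (fun d h => hd d (by simpa using h))).1
  rw [Nat.ofDigits_digits] at A
  rw [A, B, sternP_reverse]
  simp [Matrix.mul_apply, Fin.sum_univ_two, Matrix.vecMul, dotProduct]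
end

section
/- Let q ≥ 2 be an integer, A(0), …, A(q−1) complex 2×2 matrices, α, β complex numbers, and a, b, c, d complex numbers with a ≠ 0, b ≠ 0, ad − bc = 1 such that, writing A(ε) = [[a_1(ε), a_2(ε)], [a_3(ε), a_4(ε)]], one has a·b·(a_1(ε)·β − a_3(ε)·α − a_4(ε)·β) + a_2(ε)·(β + 2bc·β − cd·α) = 0 for all ε ∈ {0, …, q−1}. Put S = [[a, b], [c, d]]. Then for every ν ≥ 0 and all digits ε_0, …, ε_{ν−1} ∈ {0, …, q−1}: (a, 0)·S^{−1}·A(ε_0)⋯A(ε_{ν−1})·(α, β)^T = (1, 0)·A(ε_{ν−1})⋯A(ε_0)·S·(dα − bβ, 0)^T, where the empty matrix product is the identity matrix. -/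
open Matrix

/-- the first key identity in the proof of the main theorem:
(a, 0)·S⁻¹·A(ε₀)⋯A(ε_{ν−1})·(α, β)ᵀ = (1, 0)·A(ε_{ν−1})⋯A(ε₀)·S·(dα − bβ, 0)ᵀ. -/
theorem key_identity_first
    (q : ℕ) (hq : 2 ≤ q)
    (A : ℕ → Matrix (Fin 2) (Fin 2) ℂ) (α β : ℂ)
    (a b c d : ℂ) (ha : a ≠ 0) (hb : b ≠ 0) (hdet : a * d - b * c = 1)
    (hrel : ∀ ε : ℕ, ε < q →
      a * b * (A ε 0 0 * β - A ε 1 0 * α - A ε 1 1 * β)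
        + A ε 0 1 * (β + 2 * b * c * β - c * d * α) = 0)
    (S : Matrix (Fin 2) (Fin 2) ℂ) (hS : S = !![a, b; c, d]) :
    ∀ (ν : ℕ) (ε : Fin ν → ℕ), (∀ i, ε i < q) →
      ![a, 0] ⬝ᵥ ((S⁻¹ * ((List.ofFn ε).map A).prod).mulVec ![α, β])
        = ![(1 : ℂ), 0] ⬝ᵥ
            ((((List.ofFn ε).reverse.map A).prod * S).mulVec
              ![d * α - b * β, 0]) := by
  intro ν ε hε
  obtain ⟨m, hm⟩ : ∃ m : ℂ, a * b * m = β + 2 * b * c * β - c * d * α :=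
    ⟨(β + 2 * b * c * β - c * d * α) / (a * b), by field_simp⟩
  have hab : a * b ≠ 0 := mul_ne_zero ha hb
  set M : Matrix (Fin 2) (Fin 2) ℂ := !![α, β; β, m] with hM
  have hA : ∀ k, k < q → A k * M = M * (A k)ᵀ := by
    intro k hk
    have h := hrel k hk
    rw [← hm] at h
    have h2 : A k 0 0 * β - A k 1 0 * α - A k 1 1 * β + A k 0 1 * m = 0 := by
      apply mul_left_cancel₀ hab
      linear_combination h
    ext i j
    fin_cases i <;> fin_cases j <;>
      simp [hM, Matrix.mul_apply, Fin.sum_univ_two]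
    · ring
    · linear_combination h2
    · linear_combination -h2
    · ring
  have hP : ∀ l : List ℕ, (∀ k ∈ l, k < q) →
      (l.map A).prod * M = M * ((l.reverse.map A).prod)ᵀ := by
    intro l
    induction l with
    | nil => intro _; simp
    | cons k l ih =>
      intro h
      have h1 := ih (fun j hj => h j (List.mem_cons_of_mem _ hj))
      have h2 := hA k (h k List.mem_cons_self)
      simp only [List.map_cons, List.prod_cons, List.reverse_cons, List.map_append,
        List.prod_append, List.map_nil, List.prod_nil, mul_one, Matrix.transpose_mul]
      rw [Matrix.mul_assoc, h1, ← Matrix.mul_assoc, h2, Matrix.mul_assoc]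
  have hl := hP (List.ofFn ε) (by
    intro k hk
    obtain ⟨i, rfl⟩ := (List.mem_ofFn' _ _).1 hk
    exact hε i)
  generalize ((List.ofFn ε).map A).prod = P at hl ⊢
  generalize ((List.ofFn ε).reverse.map A).prod = R at hl ⊢
  have hinv : S⁻¹ = !![d, -b; -c, a] := by
    apply Matrix.inv_eq_right_inv
    rw [hS]
    ext i j
    fin_cases i <;> fin_cases j <;> simp [Matrix.mul_apply, Fin.sum_univ_two]
    · linear_combination hdet
    · ring
    · ring
    · linear_combination hdet
  have e0 := congrFun (congrFun hl 0) 0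
  have e1 := congrFun (congrFun hl 1) 0
  simp [hM, Matrix.mul_apply, Fin.sum_univ_two] at e0 e1
  rw [hinv, hS]
  simp [Matrix.mul_apply, Matrix.mulVec, dotProduct, Fin.sum_univ_two]
  linear_combination a * d * e0 - a * b * e1 - R 0 1 * hm + R 0 1 * β * hdet
end

section
/- Let q ≥ 2 be an integer, A(0), …, A(q−1) complex 2×2 matrices, α, β complex numbers, and a, b, c, d complex numbers with a ≠ 0, b ≠ 0, ad − bc = 1 such that, writing A(ε) = [[a_1(ε), a_2(ε)], [a_3(ε), a_4(ε)]], one has a·b·(a_1(ε)·β − a_3(ε)·α − a_4(ε)·β) + a_2(ε)·(β + 2bc·β − cd·α) = 0 for all ε ∈ {0, …, q−1}. Put S = [[a, b], [c, d]]. Then for every ν ≥ 0 and all digits ε_0, …, ε_{ν−1} ∈ {0, …, q−1}: (0, b)·S^{−1}·A(ε_0)⋯A(ε_{ν−1})·(α, β)^T = (1, 0)·A(ε_{ν−1})⋯A(ε_0)·S·(0, −cα + aβ)^T, where the empty matrix product is the identity matrix. -/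
open Matrix

theorem aux_sym (A : ℕ → Matrix (Fin 2) (Fin 2) ℂ) (M : Matrix (Fin 2) (Fin 2) ℂ) (l : List ℕ)
    (h : ∀ x ∈ l, M * A x = (A x)ᵀ * M) :
    M * (l.map A).prod = ((l.reverse.map A).prod)ᵀ * M := by
  induction l with
  | nil => simp
  | cons x l ih =>
    have h1 := h x (by simp)
    have h2 := ih (fun y hy => h y (by simp [hy]))
    simp only [List.map_cons, List.prod_cons, List.reverse_cons, List.map_append, List.prod_append,
      List.map_nil, List.prod_nil, mul_one, Matrix.transpose_mul]
    rw [← Matrix.mul_assoc, h1, Matrix.mul_assoc, h2, Matrix.mul_assoc]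

theorem aux_eig (A : ℕ → Matrix (Fin 2) (Fin 2) ℂ) (w : Fin 2 → ℂ) (l : List ℕ)
    (h : ∀ x ∈ l, ∃ m : ℂ, (A x).mulVec w = m • w) :
    ∃ m : ℂ, (l.map A).prod.mulVec w = m • w ∧ (l.reverse.map A).prod.mulVec w = m • w := by
  induction l with
  | nil => exact ⟨1, by simp⟩
  | cons x l ih =>
    obtain ⟨m, hm⟩ := h x (by simp)
    obtain ⟨n, h1, h2⟩ := ih (fun y hy => h y (by simp [hy]))
    refine ⟨m * n, ?_, ?_⟩
    · simp only [List.map_cons, List.prod_cons]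
      rw [← Matrix.mulVec_mulVec, h1, Matrix.mulVec_smul, hm, smul_smul, mul_comm]
    · simp only [List.reverse_cons, List.map_append, List.prod_append,
        List.map_cons, List.prod_cons, List.map_nil, List.prod_nil, mul_one]
      rw [← Matrix.mulVec_mulVec, hm, Matrix.mulVec_smul, h2, smul_smul]

/-- the second key identity in the proof of the main theorem:
(0, b)·S⁻¹·A(ε₀)⋯A(ε_{ν−1})·(α, β)ᵀ = (1, 0)·A(ε_{ν−1})⋯A(ε₀)·S·(0, −cα + aβ)ᵀ. -/
theorem key_identity_second
    (q : ℕ) (hq : 2 ≤ q)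
    (A : ℕ → Matrix (Fin 2) (Fin 2) ℂ) (α β : ℂ)
    (a b c d : ℂ) (ha : a ≠ 0) (hb : b ≠ 0) (hdet : a * d - b * c = 1)
    (hrel : ∀ ε : ℕ, ε < q →
      a * b * (A ε 0 0 * β - A ε 1 0 * α - A ε 1 1 * β)
        + A ε 0 1 * (β + 2 * b * c * β - c * d * α) = 0)
    (S : Matrix (Fin 2) (Fin 2) ℂ) (hS : S = !![a, b; c, d]) :
    ∀ (ν : ℕ) (ε : Fin ν → ℕ), (∀ i, ε i < q) →
      ![0, b] ⬝ᵥ ((S⁻¹ * ((List.ofFn ε).map A).prod).mulVec ![α, β])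
        = ![(1 : ℂ), 0] ⬝ᵥ
            ((((List.ofFn ε).reverse.map A).prod * S).mulVec
              ![0, -c * α + a * β]) := by
  intro ν ε hε
  have hl : ∀ x ∈ List.ofFn ε, x < q := by
    intro x hx
    obtain ⟨i, rfl⟩ := (List.mem_ofFn' ε x).1 hx
    exact hε i
  generalize List.ofFn ε = l at hl
  have hSi : S⁻¹ = !![d, -b; -c, a] := by
    apply Matrix.inv_eq_right_inv
    rw [hS]
    ext i j
    fin_cases i <;> fin_cases j <;> simp [Matrix.mul_apply, Fin.sum_univ_two] <;>
      first | ring1 | linear_combination hdet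
  rw [hSi, hS]
  by_cases hk : (a * β - c * α) * (b * β - d * α) = 0
  · have he : ∀ x ∈ l, ∃ m : ℂ, (A x).mulVec ![α, β] = m • ![α, β] := by
      intro x hx
      have hr := hrel x (hl x hx)
      by_cases h0 : α = 0
      · have hb0 : β = 0 := by
          subst h0
          simpa [ha, hb] using hk
        subst h0
        subst hb0
        refine ⟨0, ?_⟩
        ext i
        fin_cases i <;> simp [Matrix.mulVec, dotProduct, Fin.sum_univ_two]
      · have hw : α * (A x 1 0 * α + A x 1 1 * β) = β * (A x 0 0 * α + A x 0 1 * β) := by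
          apply mul_left_cancel₀ (mul_ne_zero ha hb)
          linear_combination (-α) * hr - A x 0 1 * hk - A x 0 1 * α * β * hdet
        refine ⟨(A x 0 0 * α + A x 0 1 * β) / α, ?_⟩
        ext i
        fin_cases i
        · simp [Matrix.mulVec, dotProduct, Fin.sum_univ_two]
          field_simp
        · simp [Matrix.mulVec, dotProduct, Fin.sum_univ_two]
          field_simp
          linear_combination hw
    obtain ⟨m, h1, h2⟩ := aux_eig A _ l he
    rw [← Matrix.mulVec_mulVec, ← Matrix.mulVec_mulVec, h1]
    rcases mul_eq_zero.1 hk with ht | ht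
    · have hz : (![0, -c * α + a * β] : Fin 2 → ℂ) = 0 := by
        ext i
        fin_cases i
        · simp
        · simp
          linear_combination ht
      rw [hz]
      simp [Matrix.mulVec, dotProduct, Fin.sum_univ_two]
      right
      linear_combination m * ht
    · have hz : (!![a, b; c, d]).mulVec ![0, -c * α + a * β] = ![α, β] := by
        ext i
        fin_cases i
        · simp [Matrix.mulVec, dotProduct, Fin.sum_univ_two]
          linear_combination a * ht + α * hdet
        · simp [Matrix.mulVec, dotProduct, Fin.sum_univ_two]
          linear_combination c * ht + β * hdet
      rw [hz, h2]
      simp [Matrix.mulVec, dotProduct, Fin.sum_univ_two]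
      linear_combination m * a * ht + m * α * hdet
  · have hs := aux_sym A !![-(β + 2 * b * c * β - c * d * α), a * b * β; a * b * β, -(a * b * α)] l (by
      intro x hx
      have hr := hrel x (hl x hx)
      ext i j
      fin_cases i <;> fin_cases j <;> simp [Matrix.mul_apply, Fin.sum_univ_two]
      · ring
      · linear_combination -hr
      · linear_combination hr
      · ring)
    generalize (l.map A).prod = P at hs
    generalize (l.reverse.map A).prod = Q at hs
    have e00 := congrFun (congrFun hs 0) 0
    have e01 := congrFun (congrFun hs 0) 1
    have e10 := congrFun (congrFun hs 1) 0
    have e11 := congrFun (congrFun hs 1) 1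
    simp [Matrix.mul_apply, Fin.sum_univ_two] at e00 e01 e10 e11
    simp [Matrix.mulVec, dotProduct, Matrix.mul_apply, Fin.sum_univ_two]
    apply mul_left_cancel₀ hk
    linear_combination (a * β - c * α) * (b * (α * e00 + β * e01) + d * (α * e10 + β * e11))
      + (a * β - c * α) * β * (α * (b * Q 0 0 + d * Q 0 1) - b * (P 0 0 * α + P 0 1 * β)) * hdet
end

section
/- Let τ and σ be complex numbers, set ω = 1 − σ² + τσ, and let (a_n)_{n≥0} be a sequence of complex numbers with a(0) = 0, a(1) = 1, and for all n ≥ 0: a(3n) = a(n), a(3n+1) = τ·a(n) + a(n+1), a(3n+2) = ω·a(n) + σ·a(n+1). Define the 2×2 matrices A(0) = [[1, 0], [τ, 1]], A(1) = [[τ, 1], [ω, σ]], A(2) = [[ω, σ], [0, 1]]. Then for all n ≥ 0 and all ε ∈ {0, 1, 2}, the column vector (a(3n+ε), a(3n+ε+1))^T equals A(ε)·(a(n), a(n+1))^T; consequently, for every n ≥ 1 with proper base-3 expansion n = ε_{ν−1}·3^{ν−1} + ⋯ + ε_1·3 + ε_0, one has a(n) = (1, 0)·A(ε_0)·A(ε_1)⋯A(ε_{ν−1})·(0,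 1)^T. -/
open Matrix

/-- the matrix representation of the parametrized family of
3-regular sequences: the vector recurrence, and consequently the product
representation a(n) = (1,0)·A(ε₀)⋯A(ε_{ν−1})·(0,1)ᵀ over the base-3 digits
of n (least significant digit leftmost). -/
theorem param_matrix_representation
    (τ σ : ℂ) (ω : ℂ) (hω : ω = 1 - σ ^ 2 + τ * σ)
    (a : ℕ → ℂ)
    (h0 : a 0 = 0) (h1 : a 1 = 1)
    (h3 : ∀ n : ℕ, a (3 * n) = a n)
    (h3a : ∀ n : ℕ, a (3 * n + 1) = τ * a n + a (n + 1))
    (h3b : ∀ n : ℕ, a (3 * n + 2) = ω * a n + σ * a (n + 1))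
    (A : ℕ → Matrix (Fin 2) (Fin 2) ℂ)
    (hA0 : A 0 = !![1, 0; τ, 1])
    (hA1 : A 1 = !![τ, 1; ω, σ])
    (hA2 : A 2 = !![ω, σ; 0, 1]) :
    (∀ n : ℕ, ∀ ε : ℕ, ε < 3 →
        ![a (3 * n + ε), a (3 * n + ε + 1)]
          = (A ε).mulVec ![a n, a (n + 1)])
    ∧ (∀ n : ℕ, 1 ≤ n →
        a n = (((Nat.digits 3 n).map A).prod.mulVec ![0, 1]) 0) := by
  have H : ∀ n : ℕ, ∀ ε : ℕ, ε < 3 →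
        ![a (3 * n + ε), a (3 * n + ε + 1)]
          = (A ε).mulVec ![a n, a (n + 1)] := by
    intro n ε hε
    have h3c : a (3 * n + 3) = a (n + 1) := h3 (n + 1)
    interval_cases ε
    · ext i
      fin_cases i <;> simp [hA0, Matrix.mulVec, dotProduct, Fin.sum_univ_two, h3, h3a]
    · ext i
      fin_cases i <;> simp [hA1, Matrix.mulVec, dotProduct, Fin.sum_univ_two, h3a, h3b]
    · ext i
      fin_cases i <;> simp [hA2, Matrix.mulVec, dotProduct, Fin.sum_univ_two, h3b, h3c]
  refine ⟨H, ?_⟩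
  have K : ∀ n : ℕ, ![a n, a (n + 1)] = ((Nat.digits 3 n).map A).prod.mulVec ![0, 1] := by
    intro n
    induction n using Nat.strong_induction_on with
    | _ n ih =>
      rcases Nat.eq_zero_or_pos n with rfl | hn
      · simp [h0, h1]
      · rw [Nat.digits_def' (by norm_num) hn, List.map_cons, List.prod_cons,
          ← Matrix.mulVec_mulVec, ← ih (n / 3) (by omega), ← H (n / 3) (n % 3) (by omega),
          Nat.div_add_mod]
  intro n _
  rw [← K n]
  rfl
end

section
/- Let x and y be complex numbers with x ≠ 0, and let (z_n)_{n≥0} be a sequence of complex numbers satisfying z(1) = 1, z(2n) = z(n), and z(2n+1) = x·z(n) + y·z(n+1) for all n ≥ 1. Define A(0) = [[1, 0], [x, y]] and A(1) = [[x, y], [0, 1]], and set α = (1 − y)/x, β = 1. Then for every n ≥ 1 with proper base-2 expansion n = ε_{ν−1}·2^{ν−1} + ⋯ + ε_1·2 + ε_0, one has z(n) = (1, 0)·A(ε_0)·A(ε_1)⋯A(ε_{ν−1})·(α, β)^T. -/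
open Matrix

/-- matrix product representation of a Stern-type sequence
over its base-2 digits (least significant digit leftmost), with
α = (1 − y)/x and β = 1. -/
theorem stern_type_matrix_representation
    (x y : ℂ) (hx : x ≠ 0) (z : ℕ → ℂ)
    (h1 : z 1 = 1)
    (h2 : ∀ n : ℕ, 1 ≤ n → z (2 * n) = z n)
    (h2a : ∀ n : ℕ, 1 ≤ n → z (2 * n + 1) = x * z n + y * z (n + 1))
    (A : ℕ → Matrix (Fin 2) (Fin 2) ℂ)
    (hA0 : A 0 = !![1, 0; x, y])
    (hA1 : A 1 = !![x, y; 0, 1])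
    (α β : ℂ) (hα : α = (1 - y) / x) (hβ : β = 1) :
    ∀ n : ℕ, 1 ≤ n →
      z n = (((Nat.digits 2 n).map A).prod.mulVec ![α, β]) 0 := by
  have key : ∀ n : ℕ, 1 ≤ n →
      ((Nat.digits 2 n).map A).prod.mulVec ![α, β] = ![z n, z (n + 1)] := by
    intro n
    induction n using Nat.strong_induction_on with
    | _ n ih =>
      intro hn
      by_cases hn1 : n = 1
      · subst hn1
        have hz2 : z (1 + 1) = 1 := by
          have := h2 1 le_rfl
          rw [h1] at this
          simpa using this
        have hd : Nat.digits 2 1 = [1] := by norm_num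
        have hxa : x * α + y = 1 := by
          rw [hα]; field_simp; ring
        rw [hd, h1, hz2]
        ext i
        fin_cases i <;> simp [hA1, hβ, Matrix.mulVec, dotProduct, Fin.sum_univ_two, hxa]
      · have hm : 1 ≤ n / 2 := by omega
        have ihm := ih (n / 2) (by omega) hm
        have hd : Nat.digits 2 n = (n % 2) :: Nat.digits 2 (n / 2) :=
          Nat.digits_def' (by norm_num) (by omega)
        rw [hd, List.map_cons, List.prod_cons, ← Matrix.mulVec_mulVec, ihm]
        have e1 := h2 (n / 2) hm
        have e2 := h2a (n / 2) hm
        have e3 := h2 (n / 2 + 1) (by omega)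
        rcases Nat.mod_two_eq_zero_or_one n with h | h
        · have hn2 : n = 2 * (n / 2) := by omega
          rw [← hn2] at e1 e2
          rw [h, hA0, e1, e2]
          ext i
          fin_cases i <;> simp [Matrix.mulVec, dotProduct, Fin.sum_univ_two]
        · have hn2 : 2 * (n / 2) + 1 = n := by omega
          have hn3 : 2 * (n / 2 + 1) = n + 1 := by omega
          rw [hn2] at e2
          rw [hn3] at e3
          rw [h, hA1, e2, e3]
          ext i
          fin_cases i <;> simp [Matrix.mulVec, dotProduct, Fin.sum_univ_two]
  intro n hn
  rw [key n hn]
  rfl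
end
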